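/- arXiv:2312.07811 — 2 statements merged into one kernel-verified Lean document; each statement's English description precedes it below -/
import Mathlib

section
/- Let Γ be a finitely generated group with polynomial growth rate D ≥ 1 and finite symmetric generating set S, let N ⊴ Γ be a normal subgroup of finite index κ with fixed coset representatives z_{(1)}, …, z_{(κ)} (Γ = ⋃_j z_{(j)}N) and π_N : Γ → N given by π_N(x) = z_{(j)}⁻¹x for x ∈ z_{(j)}N. Let θ be a measure-preserving action of Γ on a probability space (Ω,F,P) and c : Γ × Ω → [0,∞) a subadditive cocycle satisfying condition (I). Then for all ε, r > 0, P-almost surely there exists M > 0 such that for every integer n > M and every x ∈ Γ with ‖x‖_S < rn, one has |c(x,ω) − c(π_N(x),ω)| < εn. -/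
open MeasureTheory Filter Topology

section Defs

variable {Γ : Type*} [Group Γ]

/-- The word length of `x` with respect to a generating set `S`. -/
noncomputable def wordLength (S : Set Γ) (x : Γ) : ℕ :=
  sInf {n | ∃ l : List Γ, (∀ s ∈ l, s ∈ S) ∧ l.prod = x ∧ l.length = n}

/-- The abelianized word norm `‖x‖_S^{ab} = inf {‖y‖_S : y ∈ x[Γ,Γ]}`. -/
noncomputable def wordLengthAb (S : Set Γ) (x : Γ) : ℕ :=
  sInf {n | ∃ w ∈ commutator Γ, wordLength S (x * w) = n}

/-- `Γ` has polynomial growth rate `D` with respect to `S`. -/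
def HasPolyGrowth (S : Set Γ) (D : ℕ) : Prop :=
  ∃ k : ℝ, 1 < k ∧ ∀ r : ℝ, 1 < r →
    k⁻¹ * r ^ D ≤ (Nat.card {x : Γ | (wordLength S x : ℝ) < r} : ℝ) ∧
    (Nat.card {x : Γ | (wordLength S x : ℝ) < r} : ℝ) ≤ k * r ^ D

/-- A measure-preserving (left) action of `Γ` on a probability space. -/
def IsPMPAction {Ω : Type*} [MeasurableSpace Ω] (θ : Γ → Ω → Ω) (P : Measure Ω) : Prop :=
  θ 1 = id ∧ (∀ x y : Γ, θ (x * y) = θ x ∘ θ y) ∧ ∀ x : Γ, MeasurePreserving (θ x) P P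

/-- Ergodicity of the action `θ`. -/
def IsErgodicAction {Ω : Type*} [MeasurableSpace Ω] (θ : Γ → Ω → Ω) (P : Measure Ω) : Prop :=
  ∀ E : Set Ω, MeasurableSet E → (∀ x : Γ, θ x ⁻¹' E = E) → P E = 0 ∨ P E = 1

/-- A (nonnegative) subadditive cocycle for the action `θ`. -/
def SubadditiveCocycle {Ω : Type*} [MeasurableSpace Ω] (θ : Γ → Ω → Ω) (P : Measure Ω)
    (c : Γ → Ω → ℝ) : Prop :=
  (∀ x : Γ, Measurable (c x)) ∧ (∀ x ω, 0 ≤ c x ω) ∧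
  ∀ x y : Γ, ∀ᵐ ω ∂P, c (x * y) ω ≤ c y ω + c x (θ y ω)

end Defs

theorem ball_finite_aux {Γ : Type*} [Group Γ] (S : Set Γ) (D : ℕ) (hD : HasPolyGrowth S D)
    (r : ℝ) (hr : 1 < r) : {x : Γ | (wordLength S x : ℝ) < r}.Finite := by
  obtain ⟨k, hk, h⟩ := hD
  have h1 := (h r hr).1
  have h2 : 0 < k⁻¹ * r ^ D := by positivity
  have h3 : 0 < Nat.card {x : Γ | (wordLength S x : ℝ) < r} := by
    exact_mod_cast lt_of_lt_of_le h2 h1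
  exact Set.finite_coe_iff.1 (Nat.finite_of_card_ne_zero h3.ne')

theorem countable_aux {Γ : Type*} [Group Γ] (S : Set Γ) (D : ℕ) (hD : HasPolyGrowth S D) :
    Countable Γ := by
  rw [← Set.countable_univ_iff]
  have : (Set.univ : Set Γ) = ⋃ n : ℕ, {x : Γ | (wordLength S x : ℝ) < (n : ℝ) + 2} := by
    symm
    rw [Set.eq_univ_iff_forall]
    intro x
    rw [Set.mem_iUnion]
    refine ⟨wordLength S x, ?_⟩
    show (wordLength S x : ℝ) < (wordLength S x : ℝ) + 2
    linarith
  rw [this]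
  refine Set.countable_iUnion fun n => (ball_finite_aux S D hD _ ?_).countable
  have : (0 : ℝ) ≤ n := Nat.cast_nonneg n
  linarith

theorem eventually_small_aux {Γ : Type*} [Group Γ] (S : Set Γ)
    (D : ℕ) (hD1 : 1 ≤ D) (hD : HasPolyGrowth S D)
    {Ω : Type*} [MeasurableSpace Ω] (P : Measure Ω) [IsProbabilityMeasure P]
    (θ : Γ → Ω → Ω) (hθ : IsPMPAction θ P)
    (c : Γ → Ω → ℝ) (hc : SubadditiveCocycle θ P c)
    (β C κ' : ℝ) (g : ℝ → ℝ) (hκ' : 1 < κ') (hC : 0 < C)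
    (hg : ∀ t : ℝ, 1 ≤ t → g t ≤ C * t ^ (-(2 * (D : ℝ) + κ')))
    (hI : ∀ x : Γ, ∀ t : ℝ, β * (wordLength S x : ℝ) < t →
      P {ω | t ≤ c x ω} ≤ ENNReal.ofReal (g t))
    (ε r : ℝ) (hε : 0 < ε) (hr : 0 < r) (w : Γ) (f : Γ → Γ) :
    ∀ᵐ ω ∂P, ∀ᶠ n : ℕ in atTop, ∀ x : Γ,
      (wordLength S x : ℝ) < r * n → c w (θ (f x) ω) < ε * n := by
  have hfin := ball_finite_aux S D hD
  obtain ⟨k, hk, hk2⟩ := hD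
  set K : ℝ := k * r ^ D * (C * ε ^ (-(2 * (D : ℝ) + κ'))) with hK
  have hK0 : 0 < K := by positivity
  have ev : ∀ᶠ n : ℕ in atTop, 1 ≤ ε * (n : ℝ) ∧ β * (wordLength S w : ℝ) < ε * n ∧
      1 < r * (n : ℝ) ∧ (1 : ℝ) ≤ n := by
    have t1 : Tendsto (fun n : ℕ => ε * (n : ℝ)) atTop atTop :=
      tendsto_natCast_atTop_atTop.const_mul_atTop hε
    have t2 : Tendsto (fun n : ℕ => r * (n : ℝ)) atTop atTop :=
      tendsto_natCast_atTop_atTop.const_mul_atTop hr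
    filter_upwards [t1.eventually_ge_atTop 1, t1.eventually_gt_atTop (β * (wordLength S w : ℝ)),
      t2.eventually_gt_atTop 1, eventually_ge_atTop 1] with n h1 h2 h3 h4
    exact ⟨h1, h2, h3, by exact_mod_cast h4⟩
  obtain ⟨n0, hn0⟩ := eventually_atTop.1 ev
  let B : ℕ → Set Ω := fun n => {ω | n0 ≤ n ∧ ∃ x : Γ, (wordLength S x : ℝ) < r * n ∧
    ε * n ≤ c w (θ (f x) ω)}
  have hB : ∀ n, P (B n) ≤ ENNReal.ofReal (K * (1 / (n : ℝ) ^ 2)) := by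
    intro n
    by_cases hn : n0 ≤ n
    · obtain ⟨h1, h2, h3, h4⟩ := hn0 n hn
      have hF := hfin _ h3
      have hcard := (hk2 _ h3).2
      have hsub : B n ⊆ ⋃ x ∈ hF.toFinset, θ (f x) ⁻¹' {ω | ε * n ≤ c w ω} := by
        rintro ω ⟨_, x, hx, hx2⟩
        simp only [Set.mem_iUnion]
        exact ⟨x, by simpa using hx, hx2⟩
      have hm : MeasurableSet {ω | ε * (n : ℝ) ≤ c w ω} :=
        measurableSet_le measurable_const (hc.1 w)
      have hn' : (0 : ℝ) < n := by linarith
      calc P (B n) ≤ P (⋃ x ∈ hF.toFinset, θ (f x) ⁻¹' {ω | ε * n ≤ c w ω}) := measure_mono hsub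
        _ ≤ ∑ x ∈ hF.toFinset, P (θ (f x) ⁻¹' {ω | ε * n ≤ c w ω}) :=
            measure_biUnion_finset_le _ _
        _ ≤ ∑ x ∈ hF.toFinset, ENNReal.ofReal (C * (ε * n) ^ (-(2 * (D : ℝ) + κ'))) := by
            refine Finset.sum_le_sum fun x _ => ?_
            rw [(hθ.2.2 (f x)).measure_preimage hm.nullMeasurableSet]
            exact (hI w _ h2).trans (ENNReal.ofReal_le_ofReal (hg _ h1))
        _ = ENNReal.ofReal ((hF.toFinset.card : ℝ) * (C * (ε * n) ^ (-(2 * (D : ℝ) + κ')))) := by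
            rw [Finset.sum_const, nsmul_eq_mul, ENNReal.ofReal_mul (Nat.cast_nonneg _),
              ENNReal.ofReal_natCast]
        _ ≤ ENNReal.ofReal (K * (1 / (n : ℝ) ^ 2)) := by
            apply ENNReal.ofReal_le_ofReal
            have e1 : (hF.toFinset.card : ℝ) ≤ k * (r * n) ^ D := by
              rw [← Set.ncard_eq_toFinset_card _ hF, ← Nat.card_coe_set_eq]
              exact hcard
            have e2 : (n : ℝ) ^ D * (n : ℝ) ^ (-(2 * (D : ℝ) + κ')) ≤ 1 / (n : ℝ) ^ 2 := by
              rw [← Real.rpow_natCast, ← Real.rpow_add hn', one_div, ← Real.rpow_natCast,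
                ← Real.rpow_neg hn'.le]
              apply Real.rpow_le_rpow_of_exponent_le h4
              have : (1 : ℝ) ≤ D := by exact_mod_cast hD1
              push_cast
              linarith
            calc _ ≤ k * (r * n) ^ D * (C * (ε * n) ^ (-(2 * (D : ℝ) + κ'))) := by gcongr
              _ = K * ((n : ℝ) ^ D * (n : ℝ) ^ (-(2 * (D : ℝ) + κ'))) := by
                rw [Real.mul_rpow hε.le hn'.le, mul_pow, hK]; ring
              _ ≤ _ := by gcongr
    · have : B n = ∅ := by
        ext ω
        simp [B, hn]
      simp [this]
  have hsum : Summable fun n : ℕ => K * (1 / (n : ℝ) ^ 2) :=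
    (Real.summable_one_div_nat_pow.2 (by norm_num)).mul_left K
  have hne : ∑' n, P (B n) ≠ ⊤ := by
    refine ne_top_of_le_ne_top ?_ (ENNReal.tsum_le_tsum hB)
    rw [← ENNReal.ofReal_tsum_of_nonneg (fun n => by positivity) hsum]
    exact ENNReal.ofReal_ne_top
  filter_upwards [ae_eventually_notMem hne] with ω hω
  filter_upwards [hω, eventually_ge_atTop n0] with n h1 h2 x hx
  by_contra hcon
  exact h1 ⟨h2, x, hx, not_lt.1 hcon⟩

/-- almost surely, eventually in `n`, `|c(x,ω) − c(π_N(x),ω)| < εn` uniformly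
over `x` in the ball of radius `rn`, where `π_N(x) = z_{(j)}⁻¹ x` for `x ∈ z_{(j)} N`. -/
theorem cocycle_coset_projection_comparison {Γ : Type*} [Group Γ]
    (S : Set Γ) (hSfin : S.Finite) (hSsym : ∀ s ∈ S, s⁻¹ ∈ S)
    (hSgen : Subgroup.closure S = ⊤)
    -- `Γ` has polynomial growth rate `D ≥ 1`
    (D : ℕ) (hD1 : 1 ≤ D) (hD : HasPolyGrowth S D)
    -- `N` is a normal subgroup of finite index `κ`, with coset representatives `z`
    (N : Subgroup Γ) [N.Normal] (κ : ℕ) (hκpos : 0 < κ) (hκ : N.index = κ)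
    (z : Fin κ → Γ) (hcover : ∀ x : Γ, ∃ j : Fin κ, (z j)⁻¹ * x ∈ N)
    (π : Γ → Γ) (hπ : ∀ (x : Γ) (j : Fin κ), (z j)⁻¹ * x ∈ N → π x = (z j)⁻¹ * x)
    {Ω : Type*} [MeasurableSpace Ω] (P : Measure Ω) [IsProbabilityMeasure P]
    (θ : Γ → Ω → Ω) (hθ : IsPMPAction θ P)
    (c : Γ → Ω → ℝ) (hc : SubadditiveCocycle θ P c)
    -- Condition (I)
    (β C κ' : ℝ) (g : ℝ → ℝ) (hβ : 0 < β) (hκ' : 1 < κ') (hC : 0 < C)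
    (hg : ∀ t : ℝ, 1 ≤ t → g t ≤ C * t ^ (-(2 * (D : ℝ) + κ')))
    (hI : ∀ x : Γ, ∀ t : ℝ, β * (wordLength S x : ℝ) < t →
      P {ω | t ≤ c x ω} ≤ ENNReal.ofReal (g t)) :
    ∀ ε r : ℝ, 0 < ε → 0 < r →
      ∀ᵐ ω ∂P, ∃ M : ℕ, ∀ n : ℕ, M < n → ∀ x : Γ,
        (wordLength S x : ℝ) < r * n → |c x ω - c (π x) ω| < ε * n := by
  intro ε r hε hr
  have hcount := countable_aux S D hD
  have a1 : ∀ᵐ ω ∂P, ∀ j : Fin κ, ∀ᶠ n : ℕ in atTop, ∀ x : Γ,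
      (wordLength S x : ℝ) < r * n → c (z j) (θ ((z j)⁻¹ * x) ω) < ε * n :=
    ae_all_iff.2 fun j => eventually_small_aux S D hD1 hD P θ hθ c hc β C κ' g hκ' hC hg hI
      ε r hε hr (z j) (fun x => (z j)⁻¹ * x)
  have a2 : ∀ᵐ ω ∂P, ∀ j : Fin κ, ∀ᶠ n : ℕ in atTop, ∀ x : Γ,
      (wordLength S x : ℝ) < r * n → c (z j)⁻¹ (θ x ω) < ε * n :=
    ae_all_iff.2 fun j => eventually_small_aux S D hD1 hD P θ hθ c hc β C κ' g hκ' hC hg hI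
      ε r hε hr (z j)⁻¹ (fun x => x)
  have a3 : ∀ᵐ ω ∂P, ∀ x y : Γ, c (x * y) ω ≤ c y ω + c x (θ y ω) :=
    ae_all_iff.2 fun x => ae_all_iff.2 fun y => hc.2.2 x y
  filter_upwards [a1, a2, a3] with ω h1 h2 h3
  obtain ⟨M, hM⟩ := eventually_atTop.1 ((eventually_all.2 h1).and (eventually_all.2 h2))
  refine ⟨M, fun n hn x hx => ?_⟩
  obtain ⟨j, hj⟩ := hcover x
  rw [hπ x j hj]
  have b1 := (hM n hn.le).1 j x hx
  have b2 := (hM n hn.le).2 j x hx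
  have b3 := h3 (z j) ((z j)⁻¹ * x)
  have b4 := h3 (z j)⁻¹ x
  rw [mul_inv_cancel_left] at b3
  rw [abs_lt]
  constructor <;> linarith
end

section
/- Let Γ be a finitely generated group with polynomial growth rate D ≥ 1 and finite symmetric generating set S, N ⊴ Γ a normal nilpotent subgroup of finite index with fixed coset representatives z_{(1)}, …, z_{(κ)} and π_N(x) = z_{(j)}⁻¹x for x ∈ z_{(j)}N, and T = tor N the (finite, normal in N) torsion subgroup of N; write ⟦x⟧ := π_N(x)·T ⊆ N. Let θ be a measure-preserving action of Γ on a probability space (Ω,F,P), c : Γ × Ω → [0,∞) a subadditive cocycle satisfying condition (I), and define c′(⟦x⟧, ω) := max{ c(y, θ_z(ω)) : y ∈ ⟦x⟧, z ∈ T }. Then c and c′ are asymptotically equivalent: for every ε ∈ (0,1), P-almost surely there exists M′ > 0 such that for every x ∈ Γ with ‖x‖_S > M′, |c(x, ω) − c′(⟦x⟧, ω)| < ε‖x‖_S. -/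
open MeasureTheory Filter Topology

lemma ball_aux {Γ : Type*} [Group Γ] (S : Set Γ) (D : ℕ) (hD : HasPolyGrowth S D) :
    ∃ k : ℝ, 0 < k ∧ ∀ n : ℕ, 1 ≤ n → ∃ F : Finset Γ, (∀ x, wordLength S x ≤ n → x ∈ F) ∧
      (F.card : ℝ) ≤ k * (n : ℝ) ^ D := by
  obtain ⟨k, hk, h⟩ := hD
  refine ⟨k * 2 ^ D, by positivity, fun n hn => ?_⟩
  have hn' : (1 : ℝ) ≤ n := by exact_mod_cast hn
  obtain ⟨h1, h2⟩ := h ((n : ℝ) + 1) (by linarith)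
  have hpos : 0 < Nat.card {x : Γ | (wordLength S x : ℝ) < (n : ℝ) + 1} := by
    have : (0 : ℝ) < k⁻¹ * ((n : ℝ) + 1) ^ D := by positivity
    exact_mod_cast this.trans_le h1
  have hfin : {x : Γ | (wordLength S x : ℝ) < (n : ℝ) + 1}.Finite :=
    Set.finite_coe_iff.1 (Nat.finite_of_card_ne_zero hpos.ne')
  refine ⟨hfin.toFinset, fun x hx => ?_, ?_⟩
  · rw [Set.Finite.mem_toFinset]
    have : (wordLength S x : ℝ) ≤ n := by exact_mod_cast hx
    simp only [Set.mem_ofPred_eq]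
    linarith
  · rw [Nat.card_coe_set_eq, Set.ncard_eq_toFinset_card _ hfin] at h2
    refine h2.trans ?_
    rw [mul_assoc, ← mul_pow]
    gcongr
    linarith

lemma bc_aux {Γ : Type*} [Group Γ] (S : Set Γ)
    (D : ℕ) (hD : HasPolyGrowth S D)
    {Ω : Type*} [MeasurableSpace Ω] (P : Measure Ω)
    (θ : Γ → Ω → Ω) (hθ : ∀ x, MeasurePreserving (θ x) P P)
    (f : Ω → ℝ) (hf : Measurable f) (C t₀ : ℝ) (hC : 0 < C)
    (hP : ∀ t : ℝ, t₀ < t → 1 ≤ t → P {ω | t ≤ f ω} ≤ ENNReal.ofReal (C * (t ^ (D + 2))⁻¹))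
    (b : Γ) (ε : ℝ) (hε : 0 < ε) :
    ∀ᵐ ω ∂P, ∀ᶠ n : ℕ in atTop, ∀ x : Γ, wordLength S x = n → f (θ (b * x) ω) < ε * n := by
  obtain ⟨k, hk, hball⟩ := ball_aux S D hD
  obtain ⟨n₀, hn₀⟩ := exists_nat_gt (max 1 (max (t₀ / ε) (1 / ε)))
  let A : ℕ → Set Ω := fun n => {ω | n₀ ≤ n ∧ ∃ x : Γ, wordLength S x = n ∧ ε * n ≤ f (θ (b * x) ω)}
  have hA : ∀ n, P (A n) ≤ ENNReal.ofReal (k * C * (ε ^ (D + 2))⁻¹ * (1 / (n : ℝ) ^ 2)) := by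
    intro n
    by_cases hn : n₀ ≤ n
    · have hnr : (n₀ : ℝ) ≤ n := by exact_mod_cast hn
      have h1 : (1 : ℝ) < n := ((le_max_left _ _).trans_lt hn₀).trans_le hnr
      have h2 : t₀ / ε < n :=
        (((le_max_left _ _).trans (le_max_right _ _)).trans_lt hn₀).trans_le hnr
      have h3 : 1 / ε < n :=
        (((le_max_right _ _).trans (le_max_right _ _)).trans_lt hn₀).trans_le hnr
      rw [div_lt_iff₀ hε] at h2 h3
      obtain ⟨F, hF, hFc⟩ := hball n (by exact_mod_cast h1.le)
      have hsub : A n ⊆ ⋃ x ∈ F, {ω | ε * n ≤ f (θ (b * x) ω)} := by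
        rintro ω ⟨-, x, hx, hxω⟩
        simp only [Set.mem_iUnion]
        exact ⟨x, hF x hx.le, hxω⟩
      have hone : ∀ x ∈ F, P {ω | ε * n ≤ f (θ (b * x) ω)} ≤
          ENNReal.ofReal (C * ((ε * n) ^ (D + 2))⁻¹) := by
        intro x _
        have := (hθ (b * x)).measure_preimage
          (s := {ω | ε * n ≤ f ω}) (measurableSet_le measurable_const hf).nullMeasurableSet
        rw [Set.preimage_ofPred_eq] at this
        rw [this]
        exact hP _ (by linarith) (by linarith)
      calc P (A n) ≤ P (⋃ x ∈ F, {ω | ε * n ≤ f (θ (b * x) ω)}) := measure_mono hsub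
        _ ≤ ∑ x ∈ F, P {ω | ε * n ≤ f (θ (b * x) ω)} := measure_biUnion_finset_le _ _
        _ ≤ ∑ x ∈ F, ENNReal.ofReal (C * ((ε * n) ^ (D + 2))⁻¹) := Finset.sum_le_sum hone
        _ = ENNReal.ofReal (F.card * (C * ((ε * n) ^ (D + 2))⁻¹)) := by
          rw [Finset.sum_const, nsmul_eq_mul, ENNReal.ofReal_mul (p := (F.card : ℝ)) (by positivity),
            ENNReal.ofReal_natCast]
        _ ≤ _ := by
          apply ENNReal.ofReal_le_ofReal
          calc (F.card : ℝ) * (C * ((ε * n) ^ (D + 2))⁻¹)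
              ≤ (k * (n : ℝ) ^ D) * (C * ((ε * n) ^ (D + 2))⁻¹) := by gcongr
            _ = _ := by
              have : (n : ℝ) ≠ 0 := by linarith
              field_simp
              ring
    · have : A n = ∅ := by
        ext ω; simp [A, hn]
      rw [this]; simp
  have hsum : ∑' n, P (A n) ≠ ⊤ := by
    refine ne_top_of_le_ne_top ?_ (ENNReal.tsum_le_tsum hA)
    exact ((Real.summable_one_div_nat_pow.2 one_lt_two).mul_left _).tsum_ofReal_ne_top
  filter_upwards [ae_eventually_notMem hsum] with ω hω
  filter_upwards [hω, eventually_ge_atTop n₀] with n hn hn0 x hx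
  by_contra hcon
  exact hn ⟨hn0, x, hx, not_lt.1 hcon⟩

/-- the cocycles `c` and `c′(⟦x⟧,ω) = max{c(y,θ_z(ω)) : y ∈ ⟦x⟧, z ∈ T}`
are asymptotically equivalent: almost surely `|c(x,ω) − c′(⟦x⟧,ω)| < ε‖x‖_S` for all `x`
with `‖x‖_S` large enough. -/
theorem cocycle_asymptotic_equivalence {Γ : Type*} [Group Γ]
    (S : Set Γ) (hSfin : S.Finite) (hSsym : ∀ s ∈ S, s⁻¹ ∈ S)
    (hSgen : Subgroup.closure S = ⊤)
    -- `Γ` has polynomial growth rate `D ≥ 1`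
    (D : ℕ) (hD1 : 1 ≤ D) (hD : HasPolyGrowth S D)
    -- `N` is a normal nilpotent subgroup of finite index `κ`, with coset representatives `z`
    (N : Subgroup Γ) [N.Normal] (hNnil : Group.IsNilpotent N)
    (κ : ℕ) (hκpos : 0 < κ) (hκ : N.index = κ)
    (z : Fin κ → Γ) (hcover : ∀ x : Γ, ∃ j : Fin κ, (z j)⁻¹ * x ∈ N)
    (π : Γ → Γ) (hπ : ∀ (x : Γ) (j : Fin κ), (z j)⁻¹ * x ∈ N → π x = (z j)⁻¹ * x)
    -- `T = tor N` is the torsion subgroup of `N`: finite and normal in `N`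
    (T : Subgroup Γ) (hTN : T ≤ N) (hTfin : (T : Set Γ).Finite)
    (hTnormal : ∀ t ∈ T, ∀ v ∈ N, v * t * v⁻¹ ∈ T)
    (hTtor : ∀ y : Γ, y ∈ T ↔ y ∈ N ∧ IsOfFinOrder y)
    {Ω : Type*} [MeasurableSpace Ω] (P : Measure Ω) [IsProbabilityMeasure P]
    (θ : Γ → Ω → Ω) (hθ : IsPMPAction θ P)
    (c : Γ → Ω → ℝ) (hc : SubadditiveCocycle θ P c)
    -- Condition (I)
    (β C κ' : ℝ) (g : ℝ → ℝ) (hβ : 0 < β) (hκ' : 1 < κ') (hC : 0 < C)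
    (hg : ∀ t : ℝ, 1 ≤ t → g t ≤ C * t ^ (-(2 * (D : ℝ) + κ')))
    (hI : ∀ x : Γ, ∀ t : ℝ, β * (wordLength S x : ℝ) < t →
      P {ω | t ≤ c x ω} ≤ ENNReal.ofReal (g t))
    -- `c′(⟦x⟧,ω) = max{ c(y, θ_z(ω)) : y ∈ ⟦x⟧ = π_N(x)·T, z ∈ T }`
    (c' : Γ → Ω → ℝ)
    (hc' : ∀ x ω, c' x ω =
      sSup {r | ∃ u ∈ (T : Set Γ), ∃ v ∈ (T : Set Γ), r = c (π x * u) (θ v ω)}) :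
    ∀ ε : ℝ, 0 < ε → ε < 1 →
      ∀ᵐ ω ∂P, ∃ M' : ℝ, 0 < M' ∧ ∀ x : Γ,
        M' < (wordLength S x : ℝ) → |c x ω - c' x ω| < ε * (wordLength S x : ℝ) := by
  intro ε hε hε1
  obtain ⟨hθ1, hθm, hθp⟩ := hθ
  obtain ⟨hcm, hc0, hcs⟩ := hc
  have hcount : Countable Γ := by
    obtain ⟨k, hk, hball⟩ := ball_aux S D hD
    rw [← Set.countable_univ_iff]
    choose F hF _ using fun n : ℕ => hball (n + 1) (by omega)
    refine (Set.countable_iUnion fun n => (F n).countable_toSet).mono fun x _ => ?_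
    exact Set.mem_iUnion.2 ⟨wordLength S x, hF _ x (by omega)⟩
  have hP : ∀ w : Γ, ∀ t : ℝ, β * (wordLength S w : ℝ) < t → 1 ≤ t →
      P {ω | t ≤ c w ω} ≤ ENNReal.ofReal (C * (t ^ (D + 2))⁻¹) := by
    intro w t h1 h2
    refine (hI w t h1).trans (ENNReal.ofReal_le_ofReal ((hg t h2).trans ?_))
    gcongr
    rw [← Real.rpow_natCast, ← Real.rpow_neg (by linarith)]
    apply Real.rpow_le_rpow_of_exponent_le h2
    have : (1 : ℝ) ≤ D := by exact_mod_cast hD1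
    push_cast
    linarith
  have hB : ∀ᵐ ω ∂P, ∀ w b : Γ, ∀ᶠ n : ℕ in atTop, ∀ x : Γ, wordLength S x = n →
      c w (θ (b * x) ω) < ε / 3 * n := by
    rw [ae_all_iff]; intro w
    rw [ae_all_iff]; intro b
    exact bc_aux S D hD P θ hθp (c w) (hcm w) C _ hC (hP w) b (ε / 3) (by positivity)
  have hcs' : ∀ᵐ ω ∂P, ∀ x y : Γ, c (x * y) ω ≤ c y ω + c x (θ y ω) := by
    rw [ae_all_iff]; intro x
    rw [ae_all_iff]; intro y
    exact hcs x y
  have hcs'' : ∀ᵐ ω ∂P, ∀ v x y : Γ, c (x * y) (θ v ω) ≤ c y (θ v ω) + c x (θ y (θ v ω)) := by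
    rw [ae_all_iff]; intro v
    exact (hθp v).quasiMeasurePreserving.ae hcs'
  filter_upwards [hB, hcs', hcs''] with ω hBω hs hsv
  have e1 : ∀ᶠ n : ℕ in atTop, ∀ v ∈ (T : Set Γ), c v⁻¹ (θ v ω) < ε / 3 * n := by
    rw [eventually_all_finite hTfin]
    intro v _
    have : Tendsto (fun n : ℕ => ε / 3 * (n : ℝ)) atTop atTop :=
      tendsto_natCast_atTop_atTop.const_mul_atTop (by positivity)
    exact this.eventually_gt_atTop _
  have e2 : ∀ᶠ n : ℕ in atTop, ∀ t ∈ (T : Set Γ), ∀ j : Fin κ, ∀ x : Γ, wordLength S x = n →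
      c (t * (z j)⁻¹) (θ (1 * x) ω) < ε / 3 * n := by
    rw [eventually_all_finite hTfin]
    intro t _
    rw [eventually_all]
    intro j
    exact hBω _ _
  have e3 : ∀ᶠ n : ℕ in atTop, ∀ j : Fin κ, ∀ x : Γ, wordLength S x = n →
      c (z j) (θ ((z j)⁻¹ * x) ω) < ε / 3 * n := by
    rw [eventually_all]
    intro j
    exact hBω _ _
  obtain ⟨n₀, hn₀⟩ := eventually_atTop.1 (e1.and (e2.and e3))
  refine ⟨(n₀ : ℝ) + 1, by positivity, fun x hx => ?_⟩
  have hxn : n₀ ≤ wordLength S x := by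
    have : (n₀ : ℝ) ≤ wordLength S x := by linarith
    exact_mod_cast this
  have hLpos : (0 : ℝ) < wordLength S x := by
    have : (0 : ℝ) ≤ n₀ := by positivity
    linarith
  obtain ⟨h1, h2, h3⟩ := hn₀ _ hxn
  obtain ⟨j, hj⟩ := hcover x
  have hπx := hπ x j hj
  have hub : ∀ r ∈ {r | ∃ u ∈ (T : Set Γ), ∃ v ∈ (T : Set Γ), r = c (π x * u) (θ v ω)},
      r ≤ c x ω + 2 * (ε / 3 * (wordLength S x : ℝ)) := by
    rintro r ⟨u, hu, v, hv, rfl⟩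
    have ht : π x * (u * v) * (π x)⁻¹ ∈ T :=
      hTnormal _ (T.mul_mem hu hv) _ (by rw [hπx]; exact hj)
    generalize htd : π x * (u * v) * (π x)⁻¹ = t at ht
    have hy : π x * u = (t * (z j)⁻¹ * x) * v⁻¹ := by
      rw [← htd, hπx]; group
    have a1 := hsv v (t * (z j)⁻¹ * x) v⁻¹
    have hid : θ v⁻¹ (θ v ω) = ω := by
      have := congrFun (hθm v⁻¹ v) ω
      rw [inv_mul_cancel, hθ1] at this
      exact this.symm
    rw [hid, ← hy] at a1
    have a2 := hs (t * (z j)⁻¹) x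
    have a3 := h1 v hv
    have a4 := h2 t ht j x rfl
    rw [one_mul] at a4
    linarith
  have hmem : c (π x) ω ∈ {r | ∃ u ∈ (T : Set Γ), ∃ v ∈ (T : Set Γ), r = c (π x * u) (θ v ω)} :=
    ⟨1, T.one_mem, 1, T.one_mem, by rw [mul_one, hθ1]; rfl⟩
  have u1 : c' x ω ≤ c x ω + 2 * (ε / 3 * (wordLength S x : ℝ)) := by
    rw [hc']; exact csSup_le ⟨_, hmem⟩ hub
  have u2 : c (π x) ω ≤ c' x ω := by
    rw [hc']; exact le_csSup ⟨_, hub⟩ hmem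
  have u3 := hs (z j) ((z j)⁻¹ * x)
  rw [mul_inv_cancel_left, ← hπx] at u3
  have u4 := h3 j x rfl
  rw [← hπx] at u4
  have : 0 < ε * (wordLength S x : ℝ) := by positivity
  rw [abs_lt]
  constructor <;> linarith
end
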